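/- Let B be an n×n board each of whose tiles is coloured independently and uniformly at random from c ≥ 4 colours. Then with probability at least 1 - e^{-Ω(n)}, every path from (1,1) to (n,n) has cost greater than 2(3/10 - 1/c)(n-1), where the cost of a path is the number of maximal monochromatic runs along the path minus one. Consequently the minimum number of Flood-It moves exceeds 2(3/10 - 1/c)(n-1) with high probability. -/

import Mathlib

/-- Tiles of an `n × n` board. -/
abbrev Tile (n : ℕ) := Fin n × Fin n

/-- Two tiles are adjacent if they differ by a unit step (horizontally or vertically). -/
def adjT {n : ℕ} (p q : Tile n) : Prop :=
  ((p.1 : ℤ) - (q.1 : ℤ)).natAbs + ((p.2 : ℤ) - (q.2 : ℤ)).natAbs = 1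

/-- A board assigns one of `c` colours to each tile. -/
abbrev Board (n c : ℕ) := Tile n → Fin c

/-- `SameColorConn B p q` : `q` is in the monochromatic connected region of `B`
containing `p`. -/
def SameColorConn {n c : ℕ} (B : Board n c) (p q : Tile n) : Prop :=
  Relation.ReflTransGen (fun a b => adjT a b ∧ B a = B b) p q

open Classical in
/-- A Flood-It move: recolour the monochromatic region containing `o` with colour `k`. -/
noncomputable def flood {n c : ℕ} (B : Board n c) (o : Tile n) (k : Fin c) : Board n c :=
  fun p => if SameColorConn B o p then k else B p

/-- Play a sequence of Flood-It moves (flooding from `o`). -/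
noncomputable def playMoves {n c : ℕ} (o : Tile n) : Board n c → List (Fin c) → Board n c
  | B, [] => B
  | B, k :: ks => playMoves o (flood B o k) ks

/-- A board is flooded when it is monochromatic. -/
def Flooded {n c : ℕ} (B : Board n c) : Prop := ∀ p q : Tile n, B p = B q

/-- `floodMoves B o` : the minimum number of moves (flooding from `o`) needed to
flood the board `B`. -/
noncomputable def floodMoves {n c : ℕ} (B : Board n c) (o : Tile n) : ℕ :=
  sInf {l : ℕ | ∃ ms : List (Fin c), ms.length = l ∧ Flooded (playMoves o B ms)}

lemma adjT_symm {n : ℕ} {p q : Tile n} (h : adjT p q) : adjT q p := by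
  unfold adjT at *
  omega

/-- `CostLe B q u d` : some walk from `u` to `q` has at most `d` colour changes in `B`. -/
inductive CostLe {n c : ℕ} (B : Board n c) (q : Tile n) : Tile n → ℕ → Prop
  | nil (d : ℕ) : CostLe B q q d
  | cons_same {u v : Tile n} {d : ℕ} :
      adjT u v → B u = B v → CostLe B q v d → CostLe B q u d
  | cons {u v : Tile n} {d : ℕ} : adjT u v → CostLe B q v d → CostLe B q u (d + 1)

lemma CostLe.succ {n c : ℕ} {B : Board n c} {q u : Tile n} {d : ℕ} (h : CostLe B q u d) :
    CostLe B q u (d + 1) := by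
  induction h with
  | nil d => exact .nil _
  | cons_same hadj hB _ ih => exact .cons_same hadj hB ih
  | cons hadj _ ih => exact .cons hadj ih

lemma CostLe.of_sameColorConn {n c : ℕ} {B : Board n c} {q u v : Tile n} {d : ℕ}
    (huv : SameColorConn B u v) (h : CostLe B q v d) : CostLe B q u d := by
  induction huv using Relation.ReflTransGen.head_induction_on with
  | refl => exact h
  | head hab _ ih => exact .cons_same hab.1 hab.2 ih

lemma CostLe.of_fin_path {n c : ℕ} (B : Board n c) (ℓ : ℕ) (p : Fin (ℓ + 1) → Tile n)
    (hp : ∀ i : Fin ℓ, adjT (p i.castSucc) (p i.succ)) :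
    CostLe B (p (Fin.last ℓ)) (p 0)
      (Finset.univ.filter (fun i : Fin ℓ => B (p i.castSucc) ≠ B (p i.succ))).card := by
  induction ℓ with
  | zero => exact .nil _
  | succ ℓ ih =>
    have h := ih (fun i => p i.succ) (fun i => hp i.succ)
    have h0 : adjT (p 0) (p 1) := hp 0
    rw [Fin.card_filter_univ_succ]
    split_ifs with hB
    · exact .cons h0 h
    · exact .cons_same h0 (not_not.mp hB) h

lemma reflTransGen_adjT {n : ℕ} (p q : Tile n) : Relation.ReflTransGen adjT p q := by
  have key : ∀ (hn : 0 < n) (m : ℕ) (p : Tile n), p.1.val + p.2.val = m →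
      Relation.ReflTransGen adjT p (⟨0, hn⟩, ⟨0, hn⟩) := by
    intro hn m
    induction m with
    | zero =>
      rintro ⟨⟨a, ha⟩, ⟨b, hb⟩⟩ h
      obtain ⟨rfl, rfl⟩ : a = 0 ∧ b = 0 := by simpa using h
      exact .refl
    | succ m ih =>
      rintro ⟨⟨a, ha⟩, ⟨b, hb⟩⟩ h
      simp only at h
      rcases Nat.eq_zero_or_pos a with rfl | ha0
      · refine .head (b := (⟨0, ha⟩, ⟨b - 1, by omega⟩)) ?_ (ih _ (by simp only; omega))
        simp only [adjT]
        omega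
      · refine .head (b := (⟨a - 1, by omega⟩, ⟨b, hb⟩)) ?_ (ih _ (by simp only; omega))
        simp only [adjT]
        omega
  have hn : 0 < n := p.1.pos
  refine (key hn _ p rfl).trans ?_
  have : Std.Symm (adjT (n := n)) := ⟨fun _ _ => adjT_symm⟩
  exact symm_of _ (key hn _ q rfl)

lemma flood_of_conn {n c : ℕ} {B : Board n c} {o p : Tile n} (k : Fin c)
    (h : SameColorConn B o p) : flood B o k p = k := if_pos h

lemma flood_of_not_conn {n c : ℕ} {B : Board n c} {o p : Tile n} (k : Fin c)
    (h : ¬ SameColorConn B o p) : flood B o k p = B p := if_neg h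

lemma SameColorConn.color_eq {n c : ℕ} {B : Board n c} {o p : Tile n}
    (h : SameColorConn B o p) : B o = B p := by
  induction h with
  | refl => rfl
  | tail _ hbc ih => exact ih.trans hbc.2

lemma SameColorConn.flood {n c : ℕ} {B : Board n c} {o p : Tile n} (k : Fin c)
    (h : SameColorConn B o p) : SameColorConn (flood B o k) o p := by
  induction h with
  | refl => exact .refl
  | tail hab hbc ih =>
    refine .tail ih ⟨hbc.1, ?_⟩
    rw [flood_of_conn k hab, flood_of_conn k (.tail hab hbc)]

lemma exists_adjT_not_conn {n c : ℕ} {B : Board n c} {o p : Tile n}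
    (h : ¬ SameColorConn B o p) :
    ∃ a b, SameColorConn B o a ∧ ¬ SameColorConn B o b ∧ adjT a b := by
  by_contra! hcon
  refine h ?_
  induction reflTransGen_adjT o p with
  | refl => exact .refl
  | @tail b d _ hbd ih =>
    by_contra hd
    by_cases hb : SameColorConn B o b
    · exact hcon _ _ hb hd hbd
    · exact hb (ih hb)

open Classical in
/-- Every board can be flooded. -/
lemma exists_flooded_playMoves {n c : ℕ} (o : Tile n) (B : Board n c) :
    ∃ ms : List (Fin c), Flooded (playMoves o B ms) := by
  induction hm : (Finset.univ.filter fun p => ¬ SameColorConn B o p).card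
    using Nat.strong_induction_on generalizing B with
  | _ m ih =>
  by_cases hall : ∀ p, SameColorConn B o p
  · exact ⟨[], fun p q => (hall p).color_eq.symm.trans (hall q).color_eq⟩
  obtain ⟨p, hp⟩ := not_forall.mp hall
  obtain ⟨a, b, ha, hb, hab⟩ := exists_adjT_not_conn hp
  have hb' : SameColorConn (flood B o (B b)) o b :=
    .tail (ha.flood _) ⟨hab, by rw [flood_of_conn _ ha, flood_of_not_conn _ hb]⟩
  obtain ⟨ms, hms⟩ := ih _ (by
    rw [← hm]
    refine Finset.card_lt_card (Finset.ssubset_iff_of_subset ?_ |>.mpr ⟨b, by simpa using hb, ?_⟩)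
    · intro x hx
      simp only [Finset.mem_filter, Finset.mem_univ, true_and] at hx ⊢
      exact fun h => hx (h.flood _)
    · simpa using hb') (flood B o (B b)) rfl
  exact ⟨B b :: ms, hms⟩

/-- A move lowers the cost of reaching a tile from the flooding origin by at most one. -/
lemma CostLe.of_flood {n c : ℕ} {B : Board n c} {o q : Tile n} {k : Fin c} {d : ℕ}
    (h : CostLe (flood B o k) q o d) : CostLe B q o (d + 1) := by
  have key : ∀ {u d}, CostLe (flood B o k) q u d →
      (¬ SameColorConn B o u ∧ CostLe B q u d) ∨ CostLe B q o (d + 1) := by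
    intro u d h
    induction h with
    | nil d =>
      by_cases hq : SameColorConn B o q
      · exact .inr (.of_sameColorConn hq (.nil _))
      · exact .inl ⟨hq, .nil _⟩
    | @cons_same u v d hadj hB _ ih =>
      rcases ih with ⟨hv, ih⟩ | ih
      · by_cases hu : SameColorConn B o u
        · exact .inr (.of_sameColorConn hu (.cons hadj ih))
        · rw [flood_of_not_conn k hu, flood_of_not_conn k hv] at hB
          exact .inl ⟨hu, .cons_same hadj hB ih⟩
      · exact .inr ih
    | @cons u v d hadj _ ih =>
      rcases ih with ⟨hv, ih⟩ | ih
      · by_cases hu : SameColorConn B o u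
        · exact .inr (.of_sameColorConn hu (CostLe.cons hadj ih).succ)
        · exact .inl ⟨hu, .cons hadj ih⟩
      · exact .inr ih.succ
  rcases key h with ⟨ho, _⟩ | h
  · exact absurd .refl ho
  · exact h

lemma costLe_of_flooded {n c : ℕ} {o : Tile n} (q : Tile n) (ms : List (Fin c)) (B : Board n c)
    (h : Flooded (playMoves o B ms)) : CostLe B q o ms.length := by
  induction ms generalizing B with
  | nil =>
    have hB : Flooded B := h
    refine .of_sameColorConn (v := q) ?_ (.nil _)
    exact Relation.ReflTransGen.mono (fun a b hab => ⟨hab, hB a b⟩) _ _ (reflTransGen_adjT o q)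
  | cons k ms ih => exact (ih _ h).of_flood

lemma costLe_floodMoves {n c : ℕ} (B : Board n c) (o q : Tile n) :
    CostLe B q o (floodMoves B o) := by
  obtain ⟨ms₀, hms₀⟩ := exists_flooded_playMoves o B
  obtain ⟨ms, hlen, hms⟩ := Nat.sInf_mem
    (s := {l : ℕ | ∃ ms : List (Fin c), ms.length = l ∧ Flooded (playMoves o B ms)})
    ⟨_, ms₀, rfl, hms₀⟩
  rw [floodMoves, ← hlen]
  exact costLe_of_flooded q ms B hms

/-- The number of colour changes along a list of tiles. -/
def colourChanges {n c : ℕ} (B : Board n c) : List (Tile n) → ℕ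
  | a :: b :: l => (if B b = B a then 0 else 1) + colourChanges B (b :: l)
  | _ => 0

/-- Self-avoiding paths ending at `q`. -/
inductive SimplePath {n : ℕ} (q : Tile n) : List (Tile n) → Prop
  | single : SimplePath q [q]
  | cons {v u : Tile n} {l : List (Tile n)} :
      SimplePath q (u :: l) → adjT v u → v ∉ u :: l → SimplePath q (v :: u :: l)

lemma SimplePath.nodup {n : ℕ} {q : Tile n} {l : List (Tile n)} (h : SimplePath q l) :
    l.Nodup := by
  induction h with
  | single => simp
  | cons _ _ hv ih => exact List.nodup_cons.mpr ⟨hv, ih⟩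

lemma SimplePath.dist_lt_length {n : ℕ} {q u : Tile n} {l : List (Tile n)}
    (h : SimplePath q (u :: l)) :
    ((u.1 : ℤ) - q.1).natAbs + ((u.2 : ℤ) - q.2).natAbs ≤ l.length := by
  generalize hm : u :: l = m at h
  induction h generalizing u l with
  | single => obtain ⟨rfl, rfl⟩ := List.cons.inj hm; simp
  | cons _ hadj _ ih =>
    obtain ⟨rfl, rfl⟩ := List.cons.inj hm
    have := ih rfl
    unfold adjT at hadj
    simp only [List.length_cons]
    omega

lemma SimplePath.exists_suffix {n c : ℕ} (B : Board n c) {q w : Tile n} {l : List (Tile n)}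
    (h : SimplePath q l) (hw : w ∈ l) :
    ∃ l', SimplePath q (w :: l') ∧ colourChanges B (w :: l') ≤ colourChanges B l := by
  induction h with
  | single =>
    obtain rfl := List.mem_singleton.mp hw
    exact ⟨[], .single, le_rfl⟩
  | @cons v u l h hadj hv ih =>
    rcases List.mem_cons.mp hw with rfl | hw
    · exact ⟨_, h.cons hadj hv, le_rfl⟩
    · obtain ⟨l', h1, h2⟩ := ih hw
      exact ⟨l', h1, h2.trans (by simp [colourChanges])⟩

lemma CostLe.exists_simplePath {n c : ℕ} {B : Board n c} {q u : Tile n} {d : ℕ}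
    (h : CostLe B q u d) : ∃ l, SimplePath q (u :: l) ∧ colourChanges B (u :: l) ≤ d := by
  induction h with
  | nil d => exact ⟨[], .single, by simp [colourChanges]⟩
  | @cons_same u v d hadj hB _ ih =>
    obtain ⟨l, h1, h2⟩ := ih
    by_cases hu : u ∈ v :: l
    · obtain ⟨l', h3, h4⟩ := h1.exists_suffix B hu
      exact ⟨l', h3, h4.trans h2⟩
    · exact ⟨_, h1.cons hadj hu, by simpa [colourChanges, hB] using h2⟩
  | @cons u v d hadj _ ih =>
    obtain ⟨l, h1, h2⟩ := ih
    by_cases hu : u ∈ v :: l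
    · obtain ⟨l', h3, h4⟩ := h1.exists_suffix B hu
      exact ⟨l', h3, by omega⟩
    · refine ⟨_, h1.cons hadj hu, ?_⟩
      rw [colourChanges]
      split_ifs <;> omega

open Classical in
/-- The tiles adjacent to `v`. -/
noncomputable def nbrs {n : ℕ} (v : Tile n) : Finset (Tile n) :=
  Finset.univ.filter fun w => adjT w v

lemma card_nbrs_le {n : ℕ} (v : Tile n) : (nbrs v).card ≤ 4 := by
  refine (Finset.card_le_card_of_injOn (t := ({(1, 0), (-1, 0), (0, 1), (0, -1)} : Finset (ℤ × ℤ)))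
    (fun w => ((w.1 : ℤ) - v.1, (w.2 : ℤ) - v.2)) ?_ ?_).trans ?_
  · intro w hw
    replace hw : adjT w v := by simpa [nbrs] using hw
    unfold adjT at hw
    simp only [Finset.coe_insert, Finset.coe_singleton, Set.mem_insert_iff,
      Set.mem_singleton_iff, Prod.mk.injEq]
    omega
  · rintro ⟨⟨a, _⟩, ⟨b, _⟩⟩ _ ⟨⟨a', _⟩, ⟨b', _⟩⟩ _ h
    simp only [Prod.mk.injEq, Fin.mk.injEq] at h ⊢
    omega
  · exact Finset.card_le_four

open Classical in
/-- The self-avoiding paths with `ℓ` steps that end at `q`. -/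
noncomputable def simplePaths {n : ℕ} (q : Tile n) : ℕ → Finset (List (Tile n))
  | 0 => {[q]}
  | ℓ + 1 => (simplePaths q ℓ).biUnion fun l =>
      (Finset.univ.filter fun v => v ∉ l ∧ ∃ u ∈ l.head?, adjT v u).image (· :: l)

lemma mem_simplePaths {n : ℕ} {q : Tile n} {ℓ : ℕ} {l : List (Tile n)} :
    l ∈ simplePaths q ℓ ↔ SimplePath q l ∧ l.length = ℓ + 1 := by
  induction ℓ generalizing l with
  | zero =>
    simp only [simplePaths, Finset.mem_singleton]
    constructor
    · rintro rfl
      exact ⟨.single, rfl⟩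
    · rintro ⟨h, hl⟩
      cases h with
      | single => rfl
      | cons => simp at hl
  | succ ℓ ih =>
    simp only [simplePaths, Finset.mem_biUnion, Finset.mem_image, Finset.mem_filter,
      Finset.mem_univ, true_and, ih]
    constructor
    · rintro ⟨l, ⟨h, hl⟩, v, ⟨hv, u, hu, hadj⟩, rfl⟩
      obtain ⟨l', rfl⟩ : ∃ l', l = u :: l' := by
        cases l with
        | nil => simp at hu
        | cons a l => exact ⟨l, by simpa using hu⟩
      exact ⟨h.cons hadj hv, by simpa using hl⟩
    · rintro ⟨h, hl⟩
      cases h with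
      | single => simp at hl
      | @cons v u l h hadj hv => exact ⟨u :: l, ⟨h, by simpa using hl⟩, v, ⟨hv, u, rfl, hadj⟩, rfl⟩

lemma card_simplePaths_le {n : ℕ} (q : Tile n) (ℓ : ℕ) :
    (simplePaths q ℓ).card ≤ 2 * 3 ^ ℓ := by
  classical
  have hstep : ∀ ℓ m, (∀ l ∈ simplePaths q ℓ,
      (Finset.univ.filter fun v => v ∉ l ∧ ∃ u ∈ l.head?, adjT v u).card ≤ m) →
      (simplePaths q (ℓ + 1)).card ≤ (simplePaths q ℓ).card * m := by
    intro ℓ m h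
    rw [simplePaths]
    convert Finset.card_biUnion_le_card_mul _ _ m
      fun l hl => Finset.card_image_le.trans (h l hl)
  have hsub : ∀ u : Tile n, ∀ l, (Finset.univ.filter fun v => v ∉ u :: l ∧
      ∃ w ∈ (u :: l).head?, adjT v w) ⊆ nbrs u := by
    intro u l v hv
    simp only [List.head?_cons, Option.mem_def, Option.some.injEq, exists_eq_left',
      Finset.mem_filter, Finset.mem_univ, true_and] at hv
    simpa [nbrs] using hv.2
  match ℓ with
  | 0 => simp [simplePaths]
  | ℓ + 1 =>
    induction ℓ with
    | zero =>
      refine (hstep 0 4 fun l hl => ?_).trans (by simp [simplePaths])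
      obtain rfl : l = [q] := by simpa [simplePaths] using hl
      exact (Finset.card_le_card (hsub _ _)).trans (card_nbrs_le q)
    | succ ℓ ih =>
      refine (hstep (ℓ + 1) 3 fun l hl => ?_).trans (by rw [pow_succ]; omega)
      obtain ⟨h, hl⟩ := mem_simplePaths.mp hl
      cases h with
      | single => simp at hl
      | @cons v u l h hadj hv =>
        have hu : u ∈ nbrs v := by simpa [nbrs] using adjT_symm hadj
        have : (Finset.univ.filter fun w => w ∉ v :: u :: l ∧
            ∃ x ∈ (v :: u :: l).head?, adjT w x) ⊆ (nbrs v).erase u := by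
          intro w hw
          refine Finset.mem_erase.mpr ⟨?_, hsub _ _ hw⟩
          rintro rfl
          simp at hw
        have h1 := Finset.card_le_card this
        have h2 := card_nbrs_le v
        rw [Finset.card_erase_of_mem hu] at h1
        omega

lemma colourChanges_update {n c : ℕ} (B : Board n c) (v : Tile n) (k : Fin c)
    (l : List (Tile n)) (hv : v ∉ l) :
    colourChanges (Function.update B v k) l = colourChanges B l := by
  induction l with
  | nil => rfl
  | cons a l ih =>
    cases l with
    | nil => rfl
    | cons b l =>
      simp only [List.mem_cons, not_or] at hv ih
      rw [colourChanges, colourChanges, ih ⟨hv.2.1, hv.2.2⟩,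
        Function.update_of_ne (Ne.symm hv.1), Function.update_of_ne (Ne.symm hv.2.1)]

lemma sum_sum_update {α κ : Type*} [Fintype α] [DecidableEq α] [Fintype κ]
    (f : (α → κ) → ℝ) (v : α) :
    ∑ B, ∑ k, f (Function.update B v k) = Fintype.card κ * ∑ B, f B := by
  have : ∑ B, ∑ k, f (Function.update B v k) = ∑ B, ∑ _k : κ, f B := by
    rw [← Fintype.sum_prod_type', ← Fintype.sum_prod_type']
    refine Finset.sum_nbij' (fun x => (Function.update x.1 v x.2, x.1 v))
      (fun x => (Function.update x.1 v x.2, x.1 v)) ?_ ?_ ?_ ?_ ?_ <;> simp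
  rw [this]
  simp [Finset.mul_sum]

lemma sum_pow_colourChanges {n c : ℕ} (hc : 0 < c) (s : ℝ) (l : List (Tile n)) (a : Tile n)
    (h : (a :: l).Nodup) :
    ∑ B : Board n c, s ^ colourChanges B (a :: l)
      = (c : ℝ) ^ (n ^ 2) * ((1 + (c - 1) * s) / c) ^ l.length := by
  induction l generalizing a with
  | nil => simp [colourChanges, sq]
  | cons b l ih =>
    obtain ⟨ha, hbl⟩ := List.nodup_cons.mp h
    have hc0 : (c : ℝ) ≠ 0 := by positivity
    have hab : b ≠ a := fun hba => ha (by simp [hba])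
    have key := sum_sum_update (fun B : Board n c => s ^ colourChanges B (a :: b :: l)) a
    have hinner : ∀ B : Board n c,
        ∑ k, s ^ colourChanges (Function.update B a k) (a :: b :: l)
          = s ^ colourChanges B (b :: l) * (1 + (c - 1) * s) := by
      intro B
      simp only [colourChanges, colourChanges_update B a _ _ ha, Function.update_self,
        Function.update_of_ne hab, pow_add, pow_ite, pow_zero, pow_one]
      rw [← Finset.sum_mul, mul_comm, ← Finset.add_sum_erase _ _ (Finset.mem_univ (B b)),
        if_pos rfl, Finset.sum_congr rfl
          fun k hk => if_neg (Finset.ne_of_mem_erase hk).symm]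
      simp [Finset.card_erase_of_mem, Nat.cast_sub (Nat.succ_le_of_lt hc)]
    simp only [hinner, Fintype.card_fin] at key
    rw [← Finset.sum_mul, ih b hbl] at key
    rw [List.length_cons, pow_succ _ l.length, ← mul_right_inj' hc0, ← key]
    generalize ((1 + ((c : ℝ) - 1) * s) / c) ^ l.length = y
    field_simp

lemma length_le_of_nodup {n : ℕ} {l : List (Tile n)} (h : l.Nodup) : l.length ≤ n ^ 2 := by
  simpa [sq] using h.length_le_card

/-- First-moment bound on the number of boards with a cheap path from `u` to `q`. -/
lemma ncard_costLe_le {n c : ℕ} (hc : 0 < c) (u q : Tile n) (K s : ℝ) (hs0 : 0 < s) (hs1 : s ≤ 1)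
    (hr : 3 * ((1 + (c - 1) * s) / c) < 1) (L : ℕ)
    (hL : L ≤ ((u.1 : ℤ) - q.1).natAbs + ((u.2 : ℤ) - q.2).natAbs) :
    ({B : Board n c | ∃ d : ℕ, CostLe B q u d ∧ (d : ℝ) ≤ K}.ncard : ℝ)
      ≤ 2 * s ^ (-K) * ((3 * ((1 + (c - 1) * s) / c)) ^ L / (1 - 3 * ((1 + (c - 1) * s) / c)))
        * (c : ℝ) ^ (n ^ 2) := by
  classical
  set x : ℝ := (1 + (c - 1) * s) / c with hx
  have hc1 : (1 : ℝ) ≤ c := by exact_mod_cast hc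
  have hx0 : 0 ≤ x := div_nonneg (by nlinarith) (by linarith)
  have hpt : ∀ B : Board n c, (if ∃ d : ℕ, CostLe B q u d ∧ (d : ℝ) ≤ K then (1 : ℝ) else 0) ≤
      ∑ ℓ ∈ Finset.Ico L (n ^ 2), ∑ l ∈ simplePaths q ℓ, s ^ (-K) * s ^ colourChanges B l := by
    intro B
    split_ifs with hB
    · obtain ⟨d, hd, hdK⟩ := hB
      obtain ⟨l, hl, hld⟩ := hd.exists_simplePath
      have h1 : l.length ∈ Finset.Ico L (n ^ 2) := by
        have := length_le_of_nodup hl.nodup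
        rw [List.length_cons] at this
        exact Finset.mem_Ico.mpr ⟨hL.trans hl.dist_lt_length, this⟩
      have h2 : u :: l ∈ simplePaths q l.length := mem_simplePaths.mpr ⟨hl, rfl⟩
      have h3 : (1 : ℝ) ≤ s ^ (-K) * s ^ colourChanges B (u :: l) := by
        rw [← Real.rpow_natCast, ← Real.rpow_add hs0]
        refine Real.one_le_rpow_of_pos_of_le_one_of_nonpos hs0 hs1 ?_
        have : (colourChanges B (u :: l) : ℝ) ≤ d := by exact_mod_cast hld
        linarith
      refine h3.trans ((Finset.single_le_sum (f := fun l => s ^ (-K) * s ^ colourChanges B l)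
        (fun _ _ => by positivity) h2).trans ?_)
      exact Finset.single_le_sum
        (f := fun ℓ => ∑ l ∈ simplePaths q ℓ, s ^ (-K) * s ^ colourChanges B l)
        (fun _ _ => Finset.sum_nonneg fun _ _ => by positivity) h1
    · exact Finset.sum_nonneg fun _ _ => Finset.sum_nonneg fun _ _ => by positivity
  have hpaths : ∀ ℓ, ∑ l ∈ simplePaths q ℓ, ∑ B : Board n c, s ^ (-K) * s ^ colourChanges B l
      ≤ 2 * s ^ (-K) * (c : ℝ) ^ (n ^ 2) * (3 * x) ^ ℓ := by
    intro ℓ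
    have h1 : ∀ l ∈ simplePaths q ℓ, ∑ B : Board n c, s ^ (-K) * s ^ colourChanges B l
        = s ^ (-K) * ((c : ℝ) ^ (n ^ 2) * x ^ ℓ) := by
      intro l hl
      obtain ⟨h, hlen⟩ := mem_simplePaths.mp hl
      cases l with
      | nil => simp at hlen
      | cons a l =>
        rw [← Finset.mul_sum, sum_pow_colourChanges hc s l a h.nodup]
        simp only [List.length_cons, Nat.add_right_cancel_iff] at hlen
        rw [hlen]
    rw [Finset.sum_congr rfl h1, Finset.sum_const, nsmul_eq_mul]
    have h2 : ((simplePaths q ℓ).card : ℝ) ≤ 2 * 3 ^ ℓ := by exact_mod_cast card_simplePaths_le q ℓ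
    refine (mul_le_mul_of_nonneg_right h2 (by positivity)).trans (le_of_eq ?_)
    rw [mul_pow]
    ring
  calc ({B : Board n c | ∃ d : ℕ, CostLe B q u d ∧ (d : ℝ) ≤ K}.ncard : ℝ)
      = ∑ B : Board n c, if ∃ d : ℕ, CostLe B q u d ∧ (d : ℝ) ≤ K then (1 : ℝ) else 0 := by
        rw [Set.ncard_eq_toFinset_card']
        simp
    _ ≤ ∑ B : Board n c, ∑ ℓ ∈ Finset.Ico L (n ^ 2), ∑ l ∈ simplePaths q ℓ,
          s ^ (-K) * s ^ colourChanges B l := Finset.sum_le_sum fun B _ => hpt B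
    _ = ∑ ℓ ∈ Finset.Ico L (n ^ 2), ∑ l ∈ simplePaths q ℓ, ∑ B : Board n c,
          s ^ (-K) * s ^ colourChanges B l := by
        rw [Finset.sum_comm]
        exact Finset.sum_congr rfl fun _ _ => Finset.sum_comm
    _ ≤ ∑ ℓ ∈ Finset.Ico L (n ^ 2), 2 * s ^ (-K) * (c : ℝ) ^ (n ^ 2) * (3 * x) ^ ℓ :=
        Finset.sum_le_sum fun ℓ _ => hpaths ℓ
    _ ≤ 2 * s ^ (-K) * (c : ℝ) ^ (n ^ 2) * ((3 * x) ^ L / (1 - 3 * x)) := by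
        rw [← Finset.mul_sum]
        exact mul_le_mul_of_nonneg_left (geom_sum_Ico_le_of_lt_one (by positivity) hr)
          (by positivity)
    _ = _ := by ring

/-- The exponential-moment rate beats the growth rate `3` of self-avoiding paths. -/
lemma rate_lt_one {p : ℝ} (hp : p ≤ 1 / 4) :
    (32 : ℝ) ^ (3 / 10 - p) * (3 * ((1 + 31 * p) / 32)) < 1 := by
  have hlog : 0.6931 < Real.log 2 := by have := Real.log_two_gt_d9; norm_num at *; linarith
  have hlog' : Real.log 2 < 0.6932 := by have := Real.log_two_lt_d9; norm_num at *; linarith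
  have hsq : (1.4142 : ℝ) < √2 := Real.lt_sqrt_of_sq_lt (by norm_num)
  have hexp : 1 + 5 * Real.log 2 * (p - 1 / 5) ≤ (2 : ℝ) ^ (5 * (p - 1 / 5)) := by
    rw [Real.rpow_def_of_pos two_pos]
    have := Real.add_one_le_exp (Real.log 2 * (5 * (p - 1 / 5)))
    linarith
  have h32 : (32 : ℝ) ^ (3 / 10 - p) * (16 * √2 * (2 : ℝ) ^ (5 * (p - 1 / 5))) = 32 := by
    have h16 : (16 : ℝ) = 2 ^ (4 : ℝ) := by norm_num
    have h32' : (32 : ℝ) = 2 ^ (5 : ℝ) := by norm_num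
    rw [h16, h32', Real.sqrt_eq_rpow, ← Real.rpow_mul two_pos.le, ← Real.rpow_add two_pos,
      ← Real.rpow_add two_pos, ← Real.rpow_add two_pos]
    congr 1
    ring
  have hpos : (0 : ℝ) < 32 ^ (3 / 10 - p) := by positivity
  have hmain : 3 * (1 + 31 * p) < 16 * √2 * (2 : ℝ) ^ (5 * (p - 1 / 5)) := by
    by_cases hy : 0 ≤ 1 + 5 * Real.log 2 * (p - 1 / 5)
    · have h1 : 16 * 1.4142 * (1 + 5 * Real.log 2 * (p - 1 / 5)) ≤
          16 * √2 * (2 : ℝ) ^ (5 * (p - 1 / 5)) :=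
        mul_le_mul (by linarith) hexp hy (by positivity)
      refine lt_of_lt_of_le ?_ h1
      rcases le_total p (1 / 5) with h | h <;> nlinarith
    · have h1 : 3 * (1 + 31 * p) < 0 := by nlinarith
      exact h1.trans (by positivity)
  have := mul_lt_mul_of_pos_left hmain hpos
  rw [h32] at this
  linarith

/-- for c ≥ 4 colours, a uniformly random n×n board B has, with
probability 1 − e^(−Ω(n)), no path from the top-left to the bottom-right tile of
cost at most 2(3/10 − 1/c)(n−1) (the cost of a path is the number of colour
changes along it); consequently m(B) > 2(3/10 − 1/c)(n−1) with the same
probability.  Probabilities are expressed by counting boards: there are c^(n²)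
boards in all. -/
theorem stmt3 (c : ℕ) (hc : 4 ≤ c) :
    ∃ a : ℝ, 0 < a ∧ ∃ N : ℕ, ∀ n : ℕ, ∀ hn : 1 ≤ n, N ≤ n →
      (({B : Board n c | ∃ ℓ : ℕ, ∃ p : Fin (ℓ + 1) → Tile n,
            (∀ i : Fin ℓ, adjT (p i.castSucc) (p i.succ)) ∧
            p 0 = (⟨0, hn⟩, ⟨0, hn⟩) ∧
            p (Fin.last ℓ) = (⟨n - 1, by omega⟩, ⟨n - 1, by omega⟩) ∧
            (((Finset.univ.filter
                (fun i : Fin ℓ => B (p i.castSucc) ≠ B (p i.succ))).card : ℝ)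
              ≤ 2 * (3 / 10 - 1 / (c : ℝ)) * ((n : ℝ) - 1))}.ncard : ℝ)
          ≤ Real.exp (-a * n) * (c : ℝ) ^ (n ^ 2)) ∧
      (({B : Board n c | (floodMoves B (⟨0, hn⟩, ⟨0, hn⟩) : ℝ)
            ≤ 2 * (3 / 10 - 1 / (c : ℝ)) * ((n : ℝ) - 1)}.ncard : ℝ)
          ≤ Real.exp (-a * n) * (c : ℝ) ^ (n ^ 2)) := by
  have hc0 : (0 : ℝ) < c := by positivity
  have hp : 1 / (c : ℝ) ≤ 1 / 4 := one_div_le_one_div_of_le (by norm_num) (by exact_mod_cast hc)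
  have hp0 : 0 < 1 / (c : ℝ) := by positivity
  set p : ℝ := 1 / (c : ℝ) with hpdef
  have hx : (1 + ((c : ℝ) - 1) * (1 / 32)) / c = (1 + 31 * p) / 32 := by
    rw [hpdef]
    field_simp
    ring
  set r : ℝ := 3 * ((1 + 31 * p) / 32) with hrdef
  have hr1 : r < 1 := by rw [hrdef]; linarith
  have hr0 : 0 < r := by positivity
  set ρ : ℝ := (32 : ℝ) ^ (3 / 10 - p) * r with hρdef
  have hρ0 : 0 < ρ := by positivity
  have hρ1 : ρ < 1 := rate_lt_one hp
  set b : ℝ := -Real.log ρ with hbdef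
  have hb : 0 < b := neg_pos.mpr (Real.log_neg hρ0 hρ1)
  have hρexp : ρ = Real.exp (-b) := by rw [hbdef, neg_neg, Real.exp_log hρ0]
  set C : ℝ := 2 / (1 - r) with hCdef
  have hC : 0 < C := div_pos two_pos (by linarith)
  obtain ⟨N, hN⟩ := exists_nat_ge ((Real.log C + 2 * b) / b)
  refine ⟨b, hb, N, fun n hn hNn => ?_⟩
  have hcheap := ncard_costLe_le (n := n) (c := c) (by omega) (⟨0, hn⟩, ⟨0, hn⟩)
    (⟨n - 1, by omega⟩, ⟨n - 1, by omega⟩) (2 * (3 / 10 - p) * ((n : ℝ) - 1)) (1 / 32)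
    (by norm_num) (by norm_num) (by rw [hx]; exact hr1) (2 * (n - 1)) (by simp only; omega)
  rw [hx, ← hrdef] at hcheap
  clear_value C b ρ r
  have hbound : 2 * (1 / 32 : ℝ) ^ (-(2 * (3 / 10 - p) * ((n : ℝ) - 1)))
      * (r ^ (2 * (n - 1)) / (1 - r)) ≤ Real.exp (-b * n) := by
    have h1 : (1 / 32 : ℝ) ^ (-(2 * (3 / 10 - p) * ((n : ℝ) - 1)))
        = ((32 : ℝ) ^ (3 / 10 - p)) ^ (2 * (n - 1)) := by
      rw [one_div, Real.inv_rpow (by norm_num), Real.rpow_neg (by norm_num), inv_inv,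
        ← Real.rpow_natCast, ← Real.rpow_mul (by norm_num)]
      push_cast [Nat.cast_sub hn]
      congr 1
      ring
    have h2 : 2 * (1 / 32 : ℝ) ^ (-(2 * (3 / 10 - p) * ((n : ℝ) - 1)))
        * (r ^ (2 * (n - 1)) / (1 - r)) = C * ρ ^ (2 * (n - 1)) := by
      rw [h1, hρdef, mul_pow, hCdef]
      ring
    rw [h2, hρexp, ← Real.exp_nat_mul, ← Real.exp_log hC, ← Real.exp_add, Real.exp_le_exp]
    push_cast [Nat.cast_sub hn]
    have h3 : (Real.log C + 2 * b) / b ≤ n := hN.trans (by exact_mod_cast hNn)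
    rw [div_le_iff₀ hb] at h3
    linarith
  have hE := hcheap.trans (mul_le_mul_of_nonneg_right hbound (by positivity))
  constructor
  · refine le_trans (Nat.cast_le.mpr (Set.ncard_le_ncard ?_ (Set.toFinite _))) hE
    rintro B ⟨ℓ, w, hadj, h0, hlast, hcost⟩
    have h := CostLe.of_fin_path B ℓ w hadj
    rw [h0, hlast] at h
    exact ⟨_, h, hcost⟩
  · refine le_trans (Nat.cast_le.mpr (Set.ncard_le_ncard ?_ (Set.toFinite _))) hE
    intro B hB
    exact ⟨_, costLe_floodMoves B _ _, hB⟩
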